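/- Let α > 0 and c₀ ∈ ℝ. Suppose u, ρ : [0,∞) × ℝ → ℝ are twice continuously differentiable and satisfy pointwise the two-component DGH system with γ = 0: ∂ₜu + u∂ₓu = −∂ₓ[p ∗ ((α²/2)(∂ₓu)² + u² + c₀u + ρ²/2 + ρ)] and ∂ₜρ + u∂ₓρ + (∂ₓu)ρ + ∂ₓu = 0, where the convolution is in the space variable. Suppose further that for every t ≥ 0: u(t,·), ∂ₓu(t,·) and ρ(t,·) are square-integrable, u(t,y) → 0 as |y| → ∞, and the energy bound ∫_ℝ (u² + α²(∂ₓu)² + ρ²)(t,x) dx ≤ ∫_ℝ (u² + α²(∂ₓu)² + ρ²)(0,x) dx holds. Suppose there is a continuously differentiable map q : [0,∞) × ℝ → ℝ with q(0,x) = x and ∂ₜq(t,x) = u(t,q(t,x)), which is twice continuously differentiable in x with continuous mixed partial derivatives. If there exists x₀ ∈ ℝ with ρ(0,x₀) = −1 and ∂ₓu(0,x₀) < −(1/α)|u(0,x₀) + c₀/2|, then a contradiction follows; i.e., no such global-in-time solution exists. -/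

import Mathlib

open MeasureTheory Filter

/-- The weighted integral of `F` over the half-line `(x, ∞)` with weight `e^{(x - y)/α}`. -/
noncomputable def rightTail (α : ℝ) (F : ℝ → ℝ) (x : ℝ) : ℝ :=
  ∫ y in Set.Ioi x, Real.exp ((x - y) / α) * F y

/-- The weighted integral of `F` over the half-line `(-∞, x)` with weight `e^{(y - x)/α}`. -/
noncomputable def leftTail (α : ℝ) (F : ℝ → ℝ) (x : ℝ) : ℝ :=
  rightTail α (fun y => F (-y)) (-x)

lemma integrableOn_exp_mul_Ioi_of_le {α : ℝ} (hα : 0 < α) {F H : ℝ → ℝ} {C : ℝ}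
    (hF : Continuous F) (hH : Integrable H) (hle : ∀ y, |F y| ≤ H y + C) (z x : ℝ) :
    IntegrableOn (fun y => Real.exp ((z - y) / α) * F y) (Set.Ioi x) := by
  have hexp : IntegrableOn (fun y => Real.exp ((z - y) / α)) (Set.Ioi x) := by
    have h := (integrableOn_exp_mul_Ioi (a := -(1 / α)) (by simpa using hα) x).const_mul
      (Real.exp (z / α))
    refine IntegrableOn.congr_fun h (fun y _ => ?_) measurableSet_Ioi
    simp only [← Real.exp_add]
    congr 1
    field_simp
    ring
  have hbound : IntegrableOn
      (fun y => Real.exp ((z - x) / α) * |H y| + |C| * Real.exp ((z - y) / α)) (Set.Ioi x) :=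
    (hH.abs.integrableOn.const_mul _).add (hexp.const_mul _)
  refine Integrable.mono' hbound (by fun_prop) ?_
  refine (ae_restrict_iff' measurableSet_Ioi).2 (Eventually.of_forall fun y hy => ?_)
  have hyx : x ≤ y := le_of_lt hy
  have h1 : Real.exp ((z - y) / α) ≤ Real.exp ((z - x) / α) := by gcongr
  rw [Real.norm_eq_abs, abs_mul, abs_of_pos (Real.exp_pos _)]
  calc Real.exp ((z - y) / α) * |F y|
      ≤ Real.exp ((z - y) / α) * (|H y| + |C|) := by
        gcongr
        exact (hle y).trans (add_le_add (le_abs_self _) (le_abs_self _))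
    _ = Real.exp ((z - y) / α) * |H y| + |C| * Real.exp ((z - y) / α) := by ring
    _ ≤ _ := by gcongr

lemma hasDerivAt_rightTail {α : ℝ} {F : ℝ → ℝ} (hF : Continuous F)
    (hint : ∀ z x, IntegrableOn (fun y => Real.exp ((z - y) / α) * F y) (Set.Ioi x)) (x : ℝ) :
    HasDerivAt (rightTail α F) (rightTail α F x / α - F x) x := by
  set g : ℝ → ℝ := fun y => Real.exp ((0 - y) / α) * F y with hg
  have hgc : Continuous g := by fun_prop
  have hfac : ∀ z, rightTail α F z = Real.exp (z / α) * ∫ y in Set.Ioi z, g y := by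
    intro z
    rw [rightTail, ← integral_const_mul]
    congr 1 with y
    rw [hg, ← mul_assoc, ← Real.exp_add]
    congr 2
    ring
  have htail : ∀ z, ∫ y in Set.Ioi z, g y = (∫ y in Set.Ioi x, g y) - ∫ y in x..z, g y := by
    intro z
    rw [← intervalIntegral.integral_interval_add_Ioi (hint 0 x) (hint 0 z)]
    ring
  have hderiv : HasDerivAt (fun z => ∫ y in Set.Ioi z, g y) (-g x) x := by
    rw [funext htail]
    exact ((hgc.integral_hasStrictDerivAt x x).hasDerivAt).const_sub _
  have hexp : HasDerivAt (fun z : ℝ => Real.exp (z / α)) (Real.exp (x / α) * (1 / α)) x :=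
    ((hasDerivAt_id x).div_const α).exp
  have hcancel : Real.exp (x / α) * Real.exp ((0 - x) / α) = 1 := by
    rw [← Real.exp_add, ← Real.exp_zero]
    congr 1
    ring
  rw [show rightTail α F = fun z => Real.exp (z / α) * ∫ y in Set.Ioi z, g y from funext hfac]
  refine (hexp.mul hderiv).congr_deriv ?_
  rw [hg]
  linear_combination (-F x) * hcancel

lemma hasDerivAt_leftTail {α : ℝ} {F : ℝ → ℝ} (hF : Continuous F)
    (hint : ∀ z x, IntegrableOn (fun y => Real.exp ((z - y) / α) * F (-y)) (Set.Ioi x)) (x : ℝ) :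
    HasDerivAt (leftTail α F) (F x - leftTail α F x / α) x := by
  have h := hasDerivAt_rightTail (F := fun y => F (-y)) (by fun_prop) hint (-x)
  refine (h.comp x (hasDerivAt_neg x)).congr_deriv ?_
  simp only [leftTail, neg_neg]
  ring

lemma integral_exp_abs_eq_tails {α : ℝ} {F : ℝ → ℝ}
    (hintR : ∀ z x, IntegrableOn (fun y => Real.exp ((z - y) / α) * F y) (Set.Ioi x))
    (hintL : ∀ z x, IntegrableOn (fun y => Real.exp ((z - y) / α) * F (-y)) (Set.Ioi x)) (z : ℝ) :
    ∫ y : ℝ, (1 / (2 * α)) * Real.exp (-|z - y| / α) * F y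
      = 1 / (2 * α) * (leftTail α F z + rightTail α F z) := by
  have hR : Set.EqOn (fun y => Real.exp ((z - y) / α) * F y)
      (fun y => Real.exp (-|z - y| / α) * F y) (Set.Ioi z) := by
    intro y hy
    have hy' : z < y := hy
    simp only
    rw [abs_of_nonpos (by linarith), neg_neg]
  have hL : Set.EqOn (fun y => Real.exp ((-z - -y) / α) * F y)
      (fun y => Real.exp (-|z - y| / α) * F y) (Set.Iic z) := by
    intro y hy
    have hy' : y ≤ z := hy
    simp only
    rw [abs_of_nonneg (by linarith), show -z - -y = -(z - y) by ring]
  have hintL' : IntegrableOn (fun y => Real.exp ((-z - -y) / α) * F y) (Set.Iic z) := by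
    have h := ((integrableOn_Ici_iff_integrableOn_Ioi (by simp)).2 (hintL (-z) (-z))).comp_neg_Iic
    simpa using h
  have hleft : leftTail α F z = ∫ y in Set.Iic z, Real.exp (-|z - y| / α) * F y := by
    rw [← setIntegral_congr_fun measurableSet_Iic hL, leftTail, rightTail,
      ← integral_comp_neg_Iic z (fun y => Real.exp ((-z - y) / α) * F (-y))]
    simp only [neg_neg]
  have hright : rightTail α F z = ∫ y in Set.Ioi z, Real.exp (-|z - y| / α) * F y := by
    rw [← setIntegral_congr_fun measurableSet_Ioi hR, rightTail]
  simp_rw [mul_assoc]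
  rw [integral_const_mul, hleft, hright, intervalIntegral.integral_Iic_add_Ioi
    (hintL'.congr_fun hL measurableSet_Iic) ((hintR z z).congr_fun hR measurableSet_Ioi)]

lemma le_rightTail {α K L : ℝ} (hα : 0 < α) {F v v' : ℝ → ℝ} (hF : Continuous F)
    (hint : ∀ z x, IntegrableOn (fun y => Real.exp ((z - y) / α) * F y) (Set.Ioi x))
    (hv : ∀ y, HasDerivAt v (v' y) y) (hlim : Tendsto v atTop (nhds L))
    (hle : ∀ y, α ^ 2 / 2 * v' y ^ 2 + v y ^ 2 - K ≤ F y) (x : ℝ) :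
    α / 2 * v x ^ 2 - K * α ≤ rightTail α F x := by
  set G : ℝ → ℝ := fun y => Real.exp ((x - y) / α) * (K * α - α / 2 * v y ^ 2) with hG
  have hGd : ∀ y, HasDerivAt G
      (Real.exp ((x - y) / α) * (v y ^ 2 / 2 - α * v y * v' y - K)) y := by
    intro y
    have hexp : HasDerivAt (fun y : ℝ => Real.exp ((x - y) / α))
        (Real.exp ((x - y) / α) * (-1 / α)) y :=
      (((hasDerivAt_id y).const_sub x).div_const α).exp
    refine (hexp.mul ((((hv y).pow 2).const_mul (α / 2)).const_sub (K * α))).congr_deriv ?_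
    simp only [Nat.cast_ofNat, Pi.pow_apply]
    field_simp
    ring
  have hbound : ∀ R, x ≤ R → G R - G x ≤ ∫ y in x..R, Real.exp ((x - y) / α) * F y := by
    intro R hR
    refine intervalIntegral.sub_le_integral_of_hasDeriv_right_of_le hR
      (fun y _ => (hGd y).continuousAt.continuousWithinAt)
      (fun y _ => (hGd y).hasDerivWithinAt)
      (Continuous.integrableOn_Icc (by fun_prop)) (fun y _ => ?_)
    refine mul_le_mul_of_nonneg_left (le_trans ?_ (hle y)) (Real.exp_pos _).le
    nlinarith [sq_nonneg (α * v' y + v y)]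
  have hGlim : Tendsto G atTop (nhds 0) := by
    have h1 : Tendsto (fun y : ℝ => (x - y) / α) atTop atBot :=
      (tendsto_atBot_add_const_left _ x tendsto_neg_atTop_atBot).atBot_div_const hα
    have h2 := (Real.tendsto_exp_atBot.comp h1).mul
      (((hlim.pow 2).const_mul (α / 2)).const_sub (K * α))
    simpa [hG, Function.comp_def] using h2
  have hGx : G x = K * α - α / 2 * v x ^ 2 := by simp [hG]
  have := le_of_tendsto_of_tendsto (hGlim.sub_const (G x))
    (intervalIntegral_tendsto_integral_Ioi x (hint x x) tendsto_id)
    ((eventually_ge_atTop x).mono hbound)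
  rw [rightTail]
  linarith

lemma le_leftTail {α K L : ℝ} (hα : 0 < α) {F v v' : ℝ → ℝ} (hF : Continuous F)
    (hint : ∀ z x, IntegrableOn (fun y => Real.exp ((z - y) / α) * F (-y)) (Set.Ioi x))
    (hv : ∀ y, HasDerivAt v (v' y) y) (hlim : Tendsto v atBot (nhds L))
    (hle : ∀ y, α ^ 2 / 2 * v' y ^ 2 + v y ^ 2 - K ≤ F y) (x : ℝ) :
    α / 2 * v x ^ 2 - K * α ≤ leftTail α F x := by
  have h := le_rightTail (v := fun y => v (-y)) (v' := fun y => -v' (-y)) (K := K) hα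
    (F := fun y => F (-y)) (by fun_prop) hint
    (fun y => by simpa [Function.comp_def] using (hv (-y)).scomp y (hasDerivAt_neg y))
    (hlim.comp tendsto_neg_atTop_atBot) (fun y => by simpa using hle (-y)) (-x)
  simpa [leftTail] using h

/-- A linear differential inequality propagates lower bounds forward in time. -/
lemma exists_pos_mul_le_of_deriv_ge {f f' g : ℝ → ℝ} (hf : ContinuousOn f (Set.Ici 0))
    (hg : ContinuousOn g (Set.Ici 0)) (hd : ∀ t, 0 < t → HasDerivAt f (f' t) t)
    (hle : ∀ t, 0 < t → g t * f t ≤ f' t) {t : ℝ} (ht : 0 ≤ t) :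
    ∃ c, 0 < c ∧ f 0 * c ≤ f t := by
  set k : ℝ → ℝ := fun s => g (max 0 s) with hk
  have hkc : Continuous k :=
    hg.comp_continuous (by fun_prop) (fun s => Set.mem_Ici.2 (le_max_left _ _))
  set E : ℝ → ℝ := fun s => Real.exp (-∫ r in (0 : ℝ)..s, k r) with hE
  have hEd : ∀ s, HasDerivAt E (E s * -k s) s := fun s =>
    ((hkc.integral_hasStrictDerivAt 0 s).hasDerivAt.fun_neg).exp
  have hEc : Continuous E := continuous_iff_continuousAt.2 fun s => (hEd s).continuousAt
  have hprod : ∀ s, 0 < s → HasDerivAt (fun s => f s * E s) (f' s * E s + f s * (E s * -k s)) s :=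
    fun s hs => (hd s hs).mul (hEd s)
  have hmono : MonotoneOn (fun s => f s * E s) (Set.Ici 0) := by
    refine monotoneOn_of_deriv_nonneg (convex_Ici 0) (hf.mul hEc.continuousOn) ?_ ?_
    · intro s hs
      rw [interior_Ici] at hs
      exact (hprod s hs).differentiableAt.differentiableWithinAt
    · intro s hs
      rw [interior_Ici] at hs
      have hs' : 0 < s := hs
      rw [(hprod s hs).deriv]
      have hks : k s = g s := by simp [hk, hs'.le]
      have hEs : 0 < E s := Real.exp_pos _
      rw [hks]
      nlinarith [hle s hs]
  have h := hmono (Set.self_mem_Ici) ht ht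
  have hE0 : E 0 = 1 := by simp [hE]
  have hEt : 0 < E t := Real.exp_pos _
  refine ⟨(E t)⁻¹, inv_pos.2 hEt, ?_⟩
  simp only [hE0, mul_one] at h
  rw [← div_eq_mul_inv, div_le_iff₀ hEt]
  exact h

/-- No pair of positive functions can satisfy `A' ≥ AB/2`, `B' ≥ AB/2` for all times. -/
lemma false_of_deriv_ge_half_mul {A A' B B' : ℝ → ℝ} (hA : ContinuousOn A (Set.Ici 0))
    (hB : ContinuousOn B (Set.Ici 0)) (hdA : ∀ t, 0 < t → HasDerivAt A (A' t) t)
    (hdB : ∀ t, 0 < t → HasDerivAt B (B' t) t) (hA0 : 0 < A 0) (hB0 : 0 < B 0)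
    (hleA : ∀ t, 0 < t → A t * B t / 2 ≤ A' t) (hleB : ∀ t, 0 < t → A t * B t / 2 ≤ B' t) :
    False := by
  have hApos : ∀ t, 0 ≤ t → 0 < A t := fun t ht => by
    obtain ⟨c, hc, h⟩ := exists_pos_mul_le_of_deriv_ge (g := fun t => B t / 2) hA
      (hB.div_const 2) hdA (fun s hs => by linarith [hleA s hs]) ht
    exact (mul_pos hA0 hc).trans_le h
  have hBpos : ∀ t, 0 ≤ t → 0 < B t := fun t ht => by
    obtain ⟨c, hc, h⟩ := exists_pos_mul_le_of_deriv_ge (g := fun t => A t / 2) hB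
      (hA.div_const 2) hdB (fun s hs => by linarith [hleB s hs]) ht
    exact (mul_pos hB0 hc).trans_le h
  have hd : ∀ t, 0 < t → HasDerivAt (fun t => (A t)⁻¹ + (B t)⁻¹ + t)
      (-A' t / A t ^ 2 + -B' t / B t ^ 2 + 1) t := fun t ht =>
    (((hdA t ht).inv (hApos t ht.le).ne').add ((hdB t ht).inv (hBpos t ht.le).ne')).add
      (hasDerivAt_id t)
  have hanti : AntitoneOn (fun t => (A t)⁻¹ + (B t)⁻¹ + t) (Set.Ici 0) := by
    refine antitoneOn_of_deriv_nonpos (convex_Ici 0)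
      (((hA.inv₀ fun t ht => (hApos t ht).ne').add (hB.inv₀ fun t ht => (hBpos t ht).ne')).add
        continuousOn_id) ?_ ?_
    · intro s hs
      rw [interior_Ici] at hs
      exact (hd s hs).differentiableAt.differentiableWithinAt
    · intro s hs
      rw [interior_Ici] at hs
      have hs' : 0 < s := hs
      rw [(hd s hs).deriv]
      have hAs := hApos s hs'.le
      have hBs := hBpos s hs'.le
      have h1 : B s / (2 * A s) ≤ A' s / A s ^ 2 := by
        rw [div_le_div_iff₀ (by positivity) (by positivity)]
        nlinarith [mul_le_mul_of_nonneg_left (hleA s hs) hAs.le]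
      have h2 : A s / (2 * B s) ≤ B' s / B s ^ 2 := by
        rw [div_le_div_iff₀ (by positivity) (by positivity)]
        nlinarith [mul_le_mul_of_nonneg_left (hleB s hs) hBs.le]
      have h3 : 1 ≤ B s / (2 * A s) + A s / (2 * B s) := by
        rw [div_add_div _ _ (by positivity) (by positivity), le_div_iff₀ (by positivity)]
        nlinarith [sq_nonneg (A s - B s)]
      rw [neg_div, neg_div]
      linarith
  set T := (A 0)⁻¹ + (B 0)⁻¹ with hT
  have hT0 : 0 ≤ T := (add_pos (inv_pos.2 hA0) (inv_pos.2 hB0)).le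
  have h := hanti Set.self_mem_Ici hT0 hT0
  have h1 := inv_pos.2 (hApos T hT0)
  have h2 := inv_pos.2 (hBpos T hT0)
  simp only at h
  linarith

/-- The chain rule along a curve for `u` and its spatial derivative, with the mixed second
derivative expressed through the spatial derivative of `∂ₜu`. -/
lemma hasDerivAt_along_curve {u ut ux : ℝ → ℝ → ℝ} {q : ℝ → ℝ} {t c : ℝ}
    (hu : ContDiffAt ℝ 2 (fun p : ℝ × ℝ => u p.1 p.2) (t, q t)) (ht : 0 < t)
    (hut : ∀ t x : ℝ, 0 ≤ t → HasDerivAt (fun s => u s x) (ut t x) t)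
    (hux : ∀ t x : ℝ, 0 ≤ t → HasDerivAt (fun y => u t y) (ux t x) x)
    (hq : HasDerivAt q c t) :
    HasDerivAt (fun s => u s (q s)) (ut t (q t) + c * ux t (q t)) t ∧
    ∃ a b, HasDerivAt (fun s => ux s (q s)) (a + c * b) t ∧
      HasDerivAt (ut t) a (q t) ∧ HasDerivAt (ux t) b (q t) := by
  set U : ℝ × ℝ → ℝ := fun p => u p.1 p.2 with hU
  have hcurve : HasDerivAt (fun s => (s, q s)) ((1 : ℝ), c) t := (hasDerivAt_id t).prodMk hq
  have hsec : HasDerivAt (fun y : ℝ => (t, y)) ((0 : ℝ), (1 : ℝ)) (q t) :=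
    (hasDerivAt_const (q t) t).prodMk (hasDerivAt_id (q t))
  have hpart : ∀ᶠ p in nhds (t, q t),
      fderiv ℝ U p (1, 0) = ut p.1 p.2 ∧ fderiv ℝ U p (0, 1) = ux p.1 p.2 := by
    have h1 : ∀ᶠ p in nhds (t, q t), DifferentiableAt ℝ U p :=
      (hu.eventually (by simp)).mono fun p hp => hp.differentiableAt (by norm_num)
    have h2 : ∀ᶠ p : ℝ × ℝ in nhds (t, q t), 0 < p.1 :=
      continuousAt_fst.eventually (lt_mem_nhds ht)
    filter_upwards [h1, h2] with ⟨s, x⟩ hd hs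
    constructor
    · have h : HasDerivAt (fun r : ℝ => (r, x)) ((1 : ℝ), (0 : ℝ)) s :=
        (hasDerivAt_id s).prodMk (hasDerivAt_const s x)
      have h' := HasFDerivAt.comp_hasDerivAt (l := U) s hd.hasFDerivAt h
      exact h'.unique (hut s x hs.le)
    · have h : HasDerivAt (fun y : ℝ => (s, y)) ((0 : ℝ), (1 : ℝ)) x :=
        (hasDerivAt_const x s).prodMk (hasDerivAt_id x)
      have h' := HasFDerivAt.comp_hasDerivAt (l := U) x hd.hasFDerivAt h
      exact h'.unique (hux s x hs.le)
  obtain ⟨D, hD, hsymm⟩ : ∃ D : ℝ × ℝ →L[ℝ] ℝ × ℝ →L[ℝ] ℝ,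
      HasFDerivAt (fderiv ℝ U) D (t, q t) ∧ D (1, 0) (0, 1) = D (0, 1) (1, 0) := by
    have h1 : ContDiffAt ℝ 1 (fderiv ℝ U) (t, q t) := hu.fderiv_right (by norm_num)
    have h2 : IsSymmSndFDerivAt ℝ U (t, q t) := hu.isSymmSndFDerivAt (by simp)
    exact ⟨_, (h1.differentiableAt (by norm_num)).hasFDerivAt, h2 _ _⟩
  have hc : ((1 : ℝ), c) = (1, 0) + c • ((0 : ℝ), (1 : ℝ)) := by simp
  refine ⟨?_, D (0, 1) (1, 0), D (0, 1) (0, 1), ?_, ?_, ?_⟩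
  · have hd : HasFDerivAt U (fderiv ℝ U (t, q t)) (t, q t) :=
      (hu.differentiableAt (by norm_num)).hasFDerivAt
    have h := HasFDerivAt.comp_hasDerivAt (l := U) t hd hcurve
    refine h.congr_deriv ?_
    rw [hc, map_add, map_smul, hpart.self_of_nhds.1, hpart.self_of_nhds.2, smul_eq_mul]
  · have h := (HasFDerivAt.comp_hasDerivAt (l := fderiv ℝ U) t hD hcurve).clm_apply (hasDerivAt_const t ((0 : ℝ), (1 : ℝ)))
    refine (h.congr_deriv ?_).congr_of_eventuallyEq ?_
    · rw [hc, map_add, map_smul]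
      simp [hsymm]
    · filter_upwards [hcurve.continuousAt.eventually hpart] with s hs using hs.2.symm
  · have h := (HasFDerivAt.comp_hasDerivAt (l := fderiv ℝ U) (q t) hD hsec).clm_apply
      (hasDerivAt_const (q t) ((1 : ℝ), (0 : ℝ)))
    refine (h.congr_deriv ?_).congr_of_eventuallyEq ?_
    · simp
    · filter_upwards [hsec.continuousAt.eventually hpart] with s hs using hs.1.symm
  · have h := (HasFDerivAt.comp_hasDerivAt (l := fderiv ℝ U) (q t) hD hsec).clm_apply
      (hasDerivAt_const (q t) ((0 : ℝ), (1 : ℝ)))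
    refine (h.congr_deriv ?_).congr_of_eventuallyEq ?_
    · simp
    · filter_upwards [hsec.continuousAt.eventually hpart] with s hs using hs.2.symm

lemma uniqueDiffOn_fst_nonneg : UniqueDiffOn ℝ {p : ℝ × ℝ | 0 ≤ p.1} := by
  have h : {p : ℝ × ℝ | 0 ≤ p.1} = Set.Ici (0 : ℝ) ×ˢ Set.univ := by
    ext
    simp
  rw [h]
  exact (uniqueDiffOn_Ici 0).prod uniqueDiffOn_univ

lemma continuousOn_spatial_deriv {u ux : ℝ → ℝ → ℝ}
    (hu : ContDiffOn ℝ 2 (fun p : ℝ × ℝ => u p.1 p.2) {p : ℝ × ℝ | 0 ≤ p.1})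
    (hux : ∀ t x : ℝ, 0 ≤ t → HasDerivAt (fun y => u t y) (ux t x) x) :
    ContinuousOn (fun p : ℝ × ℝ => ux p.1 p.2) {p : ℝ × ℝ | 0 ≤ p.1} := by
  have h := (hu.continuousOn_fderivWithin uniqueDiffOn_fst_nonneg (by norm_num)).clm_apply
    (continuousOn_const (c := ((0 : ℝ), (1 : ℝ))))
  refine h.congr ?_
  rintro ⟨t, x⟩ ht
  have hd := (hu.differentiableOn (by norm_num) (t, x) ht).hasFDerivWithinAt
  have hsec : HasDerivWithinAt (fun y : ℝ => (t, y)) ((0 : ℝ), (1 : ℝ)) Set.univ x :=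
    ((hasDerivAt_const x t).prodMk (hasDerivAt_id x)).hasDerivWithinAt
  have h1 := hd.comp_hasDerivWithinAt x hsec (fun _ _ => ht)
  rw [hasDerivWithinAt_univ] at h1
  exact (hux t x ht).unique h1

/-- The half-line pieces of the nonlocal term at a fixed time: the first derivative of the
convolution, the derivatives of its pieces, and their pointwise lower bounds. -/
lemma exists_tails {α c₀ : ℝ} (hα : 0 < α) {w w' r : ℝ → ℝ}
    (hw : ∀ x, HasDerivAt w (w' x) x) (hwderiv : Continuous w') (hrc : Continuous r)
    (hw2 : Integrable fun y => w y ^ 2) (hwderiv2 : Integrable fun y => w' y ^ 2)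
    (hr2 : Integrable fun y => r y ^ 2)
    (htop : Tendsto w atTop (nhds 0)) (hbot : Tendsto w atBot (nhds 0)) :
    ∃ R L : ℝ → ℝ,
      (∀ x, HasDerivAt (fun z => ∫ y : ℝ, (1 / (2 * α)) * Real.exp (-|z - y| / α) *
        ((α ^ 2 / 2) * (w' y) ^ 2 + (w y) ^ 2 + c₀ * w y + (r y) ^ 2 / 2 + r y))
        ((R x - L x) / (2 * α ^ 2)) x) ∧
      (∀ x, HasDerivAt R (R x / α -
        ((α ^ 2 / 2) * (w' x) ^ 2 + (w x) ^ 2 + c₀ * w x + (r x) ^ 2 / 2 + r x)) x) ∧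
      (∀ x, HasDerivAt L
        ((α ^ 2 / 2) * (w' x) ^ 2 + (w x) ^ 2 + c₀ * w x + (r x) ^ 2 / 2 + r x - L x / α) x) ∧
      (∀ x, α / 2 * (w x + c₀ / 2) ^ 2 - (c₀ ^ 2 / 4 + 1 / 2) * α ≤ R x) ∧
      (∀ x, α / 2 * (w x + c₀ / 2) ^ 2 - (c₀ ^ 2 / 4 + 1 / 2) * α ≤ L x) := by
  set F : ℝ → ℝ := fun x =>
    (α ^ 2 / 2) * (w' x) ^ 2 + (w x) ^ 2 + c₀ * w x + (r x) ^ 2 / 2 + r x with hF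
  have hwc : Continuous w := continuous_iff_continuousAt.2 fun x => (hw x).continuousAt
  have hFc : Continuous F := by fun_prop
  set H : ℝ → ℝ := fun x => (α ^ 2 / 2) * (w' x) ^ 2 + 3 / 2 * (w x) ^ 2 + (r x) ^ 2 with hH
  have hHint : Integrable H := ((hwderiv2.const_mul _).add (hw2.const_mul _)).add hr2
  have hFH : ∀ y, |F y| ≤ H y + (c₀ ^ 2 / 2 + 1 / 2) := by
    intro y
    have h1 : 0 ≤ α ^ 2 / 2 * w' y ^ 2 := by positivity
    simp only [hF, hH]
    rw [abs_le]
    constructor <;>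
    nlinarith [sq_nonneg (w y + c₀), sq_nonneg (w y - c₀), sq_nonneg (r y + 1),
      sq_nonneg (r y - 1), sq_nonneg (w y), sq_nonneg (r y), sq_nonneg c₀]
  have hintR := integrableOn_exp_mul_Ioi_of_le hα hFc hHint hFH
  have hintL := integrableOn_exp_mul_Ioi_of_le (F := fun y => F (-y)) hα (by fun_prop)
    hHint.comp_neg (fun y => hFH (-y))
  have hv : ∀ y, HasDerivAt (fun x => w x + c₀ / 2) (w' y) y := fun y => (hw y).add_const _
  have hle : ∀ y, α ^ 2 / 2 * w' y ^ 2 + (w y + c₀ / 2) ^ 2 - (c₀ ^ 2 / 4 + 1 / 2) ≤ F y := by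
    intro y
    simp only [hF]
    nlinarith [sq_nonneg (r y + 1)]
  have hR := hasDerivAt_rightTail hFc hintR
  have hL := hasDerivAt_leftTail hFc hintL
  refine ⟨rightTail α F, leftTail α F, fun x => ?_, hR, hL,
    le_rightTail hα hFc hintR hv (htop.add_const _) hle,
    le_leftTail hα hFc hintL hv (hbot.add_const _) hle⟩
  rw [funext (integral_exp_abs_eq_tails hintR hintL)]
  refine (((hL x).add (hR x)).const_mul (1 / (2 * α))).congr_deriv ?_
  field_simp
  ring

/-- Local-in-space blow-up criterion for the two-component DGH system with
`γ = 0` (Theorem 1.2): no global-in-time `C²` solution `(u, ρ)` of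
`uₜ + uuₓ = -∂ₓ[p ∗ ((α²/2)uₓ² + u² + c₀u + ρ²/2 + ρ)]`,
`ρₜ + uρₓ + uₓρ + uₓ = 0` (square-integrable, decaying, with nonincreasing
energy, and admitting a particle-trajectory flow `q`) can exist if at some
point `x₀` one has `ρ₀(x₀) = -1` and `u₀′(x₀) < -(1/α)|u₀(x₀) + c₀/2|`. -/
theorem two_component_dgh_local_blowup
    (α c₀ : ℝ) (hα : 0 < α)
    (u ut ux ρ ρt ρx : ℝ → ℝ → ℝ)
    (huC2 : ContDiffOn ℝ 2 (fun p : ℝ × ℝ => u p.1 p.2) {p : ℝ × ℝ | 0 ≤ p.1})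
    (hρC2 : ContDiffOn ℝ 2 (fun p : ℝ × ℝ => ρ p.1 p.2) {p : ℝ × ℝ | 0 ≤ p.1})
    (hut : ∀ t x : ℝ, 0 ≤ t → HasDerivAt (fun s => u s x) (ut t x) t)
    (hux : ∀ t x : ℝ, 0 ≤ t → HasDerivAt (fun y => u t y) (ux t x) x)
    (hρt : ∀ t x : ℝ, 0 ≤ t → HasDerivAt (fun s => ρ s x) (ρt t x) t)
    (hρx : ∀ t x : ℝ, 0 ≤ t → HasDerivAt (fun y => ρ t y) (ρx t x) x)
    -- the two-component DGH system (γ = 0) in nonlocal form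
    (hPDEu : ∀ t x : ℝ, 0 ≤ t →
      ut t x + u t x * ux t x
        = - deriv (fun z => ∫ y : ℝ, (1 / (2 * α)) * Real.exp (-|z - y| / α) *
            ((α ^ 2 / 2) * (ux t y) ^ 2 + (u t y) ^ 2 + c₀ * u t y
              + (ρ t y) ^ 2 / 2 + ρ t y)) x)
    (hPDEρ : ∀ t x : ℝ, 0 ≤ t →
      ρt t x + u t x * ρx t x + ux t x * ρ t x + ux t x = 0)
    (hL2 : ∀ t : ℝ, 0 ≤ t →
      Integrable (fun y => (u t y) ^ 2) ∧ Integrable (fun y => (ux t y) ^ 2) ∧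
      Integrable (fun y => (ρ t y) ^ 2))
    (hdecay : ∀ t : ℝ, 0 ≤ t →
      Tendsto (fun y => u t y) atTop (nhds 0) ∧
      Tendsto (fun y => u t y) atBot (nhds 0))
    (henergy : ∀ t : ℝ, 0 ≤ t →
      (∫ y : ℝ, ((u t y) ^ 2 + α ^ 2 * (ux t y) ^ 2 + (ρ t y) ^ 2))
        ≤ ∫ y : ℝ, ((u 0 y) ^ 2 + α ^ 2 * (ux 0 y) ^ 2 + (ρ 0 y) ^ 2))
    (q qx qtx : ℝ → ℝ → ℝ)
    (hqC1 : ContDiffOn ℝ 1 (fun p : ℝ × ℝ => q p.1 p.2) {p : ℝ × ℝ | 0 ≤ p.1})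
    (hq0 : ∀ x, q 0 x = x)
    (hqt : ∀ t x : ℝ, 0 ≤ t → HasDerivAt (fun s => q s x) (u t (q t x)) t)
    (hqx : ∀ t x : ℝ, 0 ≤ t → HasDerivAt (fun y => q t y) (qx t x) x)
    -- `q` is twice continuously differentiable in `x` with continuous (hence
    -- equal) mixed partial derivatives: `∂ₜ∂ₓq = ∂ₓ∂ₜq = ∂ₓ(u(t, q(t,·)))`
    (hmix_t : ∀ t x : ℝ, 0 ≤ t → HasDerivAt (fun s => qx s x) (qtx t x) t)
    (hmix_x : ∀ t x : ℝ, 0 ≤ t → HasDerivAt (fun y => u t (q t y)) (qtx t x) x)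
    (x₀ : ℝ)
    (hρ₀ : ρ 0 x₀ = -1)
    (hx₀ : ux 0 x₀ < -(1 / α) * |u 0 x₀ + c₀ / 2|) :
    False := by
  have hin : ∀ t x : ℝ, 0 < t → {p : ℝ × ℝ | 0 ≤ p.1} ∈ nhds (t, x) := fun t x ht =>
    (continuousAt_fst.eventually (lt_mem_nhds ht) :
      ∀ᶠ p : ℝ × ℝ in nhds (t, x), 0 < p.1).mono fun _ hp => le_of_lt hp
  have hcurve : ContinuousOn (fun t => (t, q t x₀)) (Set.Ici 0) := fun t ht =>
    (continuousAt_id.prodMk (hqt t x₀ ht).continuousAt).continuousWithinAt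
  have hmaps : Set.MapsTo (fun t => (t, q t x₀)) (Set.Ici 0) {p : ℝ × ℝ | 0 ≤ p.1} :=
    fun t ht => ht
  have hmc : ContinuousOn (fun t => ux t (q t x₀)) (Set.Ici 0) :=
    (continuousOn_spatial_deriv huC2 hux).comp hcurve hmaps
  have huc : ContinuousOn (fun t => u t (q t x₀)) (Set.Ici 0) :=
    huC2.continuousOn.comp hcurve hmaps
  have hρc : ContinuousOn (fun t => ρ t (q t x₀) + 1) (Set.Ici 0) :=
    (hρC2.continuousOn.comp hcurve hmaps).add continuousOn_const
  have hslice : ∀ t, 0 ≤ t → Continuous (ux t) := fun t ht =>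
    (continuousOn_spatial_deriv huC2 hux).comp_continuous (f := fun x => (t, x)) (by fun_prop)
      (fun _ => ht)
  have hρd : ∀ t, 0 < t → HasDerivAt (fun s => ρ s (q s x₀) + 1)
      (-ux t (q t x₀) * (ρ t (q t x₀) + 1)) t := fun t ht => by
    have h := (hasDerivAt_along_curve (hρC2.contDiffAt (hin t (q t x₀) ht)) ht hρt hρx
      (hqt t x₀ ht.le)).1
    exact (h.add_const 1).congr_deriv (by linear_combination hPDEρ t (q t x₀) ht.le)
  have hρ1 : ∀ t, 0 ≤ t → ρ t (q t x₀) = -1 := fun t ht => by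
    obtain ⟨c, -, h1⟩ := exists_pos_mul_le_of_deriv_ge hρc hmc.neg hρd (fun s _ => le_rfl) ht
    obtain ⟨d, -, h2⟩ := exists_pos_mul_le_of_deriv_ge (f := fun s => -(ρ s (q s x₀) + 1))
      hρc.neg hmc.neg (fun s hs => (hρd s hs).neg) (fun s _ => (mul_neg _ _).le) ht
    simp only [hq0, hρ₀] at h1 h2
    linarith
  have hderivs : ∀ t, 0 < t → ∃ R L : ℝ,
      α / 2 * (u t (q t x₀) + c₀ / 2) ^ 2 - (c₀ ^ 2 / 4 + 1 / 2) * α ≤ R ∧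
      α / 2 * (u t (q t x₀) + c₀ / 2) ^ 2 - (c₀ ^ 2 / 4 + 1 / 2) * α ≤ L ∧
      HasDerivAt (fun s => u s (q s x₀)) (-((R - L) / (2 * α ^ 2))) t ∧
      HasDerivAt (fun s => ux s (q s x₀))
        (-(ux t (q t x₀)) ^ 2 / 2 - (R + L) / (2 * α ^ 3)
          + ((u t (q t x₀) + c₀ / 2) ^ 2 - (c₀ ^ 2 / 4 + 1 / 2)) / α ^ 2) t := by
    intro t ht
    obtain ⟨R, L, hP, hR, hL, hRle, hLle⟩ := exists_tails (c₀ := c₀) hα (hux t · ht.le)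
      (hslice t ht.le) (continuous_iff_continuousAt.2 fun x => (hρx t x ht.le).continuousAt)
      (hL2 t ht.le).1 (hL2 t ht.le).2.1 (hL2 t ht.le).2.2 (hdecay t ht.le).1 (hdecay t ht.le).2
    have hut_eq : ut t = fun x => -((R x - L x) / (2 * α ^ 2)) - u t x * ux t x := by
      funext x
      rw [← (hP x).deriv]
      linarith [hPDEu t x ht.le]
    obtain ⟨hu1, a, b, hm, ha, hb⟩ := hasDerivAt_along_curve
      (huC2.contDiffAt (hin t (q t x₀) ht)) ht hut hux (hqt t x₀ ht.le)
    refine ⟨R (q t x₀), L (q t x₀), hRle _, hLle _, hu1.congr_deriv ?_, hm.congr_deriv ?_⟩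
    · rw [hut_eq]
      ring
    · have ha' := ((((hR (q t x₀)).sub (hL (q t x₀))).div_const (2 * α ^ 2)).neg).sub
        ((hux t (q t x₀) ht.le).mul hb)
      rw [hut_eq] at ha
      rw [ha.unique ha', hρ1 t ht.le]
      field_simp
      ring
  choose! R L hRle hLle hud hmd using hderivs
  have hvc : ContinuousOn (fun t => (u t (q t x₀) + c₀ / 2) / α) (Set.Ici 0) :=
    (huc.add continuousOn_const).div_const α
  have hvd : ∀ t, 0 < t → HasDerivAt (fun t => (u t (q t x₀) + c₀ / 2) / α) _ t := fun t ht =>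
    ((hud t ht).add_const _).div_const α
  have hinit : ux 0 x₀ < -(|(u 0 x₀ + c₀ / 2) / α|) := by
    rw [abs_div, abs_of_pos hα]
    convert hx₀ using 1
    ring
  have hinit1 := neg_abs_le ((u 0 x₀ + c₀ / 2) / α)
  have hinit2 := le_abs_self ((u 0 x₀ + c₀ / 2) / α)
  have hkey : ∀ t, 0 < t → ∀ S, α / 2 * (u t (q t x₀) + c₀ / 2) ^ 2
      - (c₀ ^ 2 / 4 + 1 / 2) * α ≤ S →
      (u t (q t x₀) + c₀ / 2) ^ 2 / (2 * α ^ 2) - (c₀ ^ 2 / 4 + 1 / 2) / α ^ 2 ≤ S / α ^ 3 := by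
    intro t _ S hS
    rw [le_div_iff₀ (by positivity)]
    refine le_trans (le_of_eq ?_) hS
    field_simp
  refine false_of_deriv_ge_half_mul
    (A := fun t => -(ux t (q t x₀) + (u t (q t x₀) + c₀ / 2) / α))
    (B := fun t => -(ux t (q t x₀) - (u t (q t x₀) + c₀ / 2) / α))
    (hmc.add hvc).neg (hmc.sub hvc).neg
    (fun t ht => ((hmd t ht).add (hvd t ht)).neg) (fun t ht => ((hmd t ht).sub (hvd t ht)).neg)
    ?_ ?_ ?_ ?_
  · simp only [hq0]
    linarith
  · simp only [hq0]
    linarith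
  · intro t ht
    have h := hkey t ht _ (hRle t ht)
    refine sub_nonneg.1 ((sub_nonneg.2 h).trans (le_of_eq ?_))
    field_simp
    ring
  · intro t ht
    have h := hkey t ht _ (hLle t ht)
    refine sub_nonneg.1 ((sub_nonneg.2 h).trans (le_of_eq ?_))
    field_simp
    ring
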